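/- (d-separation implies conditional independence: spanning case.) Assume the setting of a local constraint family C over a parent assignment pa on V = Fin n with joint uncertainty set U = ⋂ i, C i, and suppose every C i is always definite. Let A, B, S be pairwise disjoint subsets of V with A ∪ B ∪ S = V. If S d-separates A and B, then A and B are conditionally independent given S with respect to U. -/

import Mathlib

/-- `k` is a descendant of `i`: `k` is reachable from `i` by the transitive
closure of the child relation (`i` is a child of `j` iff `j ∈ pa i`). -/
def Desc {n : ℕ} (pa : Fin n → Finset (Fin n)) (i k : Fin n) : Prop :=
  Relation.TransGen (fun a b => a ∈ pa b) i k

/-- `v 0, v 1, …, v m` is a trail: `m ≥ 1`, the vertices `v 0, …, v m` are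
pairwise distinct, and consecutive vertices are joined by an edge in one
direction or the other. -/
def IsTrail {n : ℕ} (pa : Fin n → Finset (Fin n)) (m : ℕ) (v : ℕ → Fin n) : Prop :=
  1 ≤ m ∧ (∀ k l, k ≤ m → l ≤ m → v k = v l → k = l) ∧
    ∀ k < m, v k ∈ pa (v (k + 1)) ∨ v (k + 1) ∈ pa (v k)

/-- The interior vertex at position `k` is a collider on the trail `v`. -/
def IsCollider {n : ℕ} (pa : Fin n → Finset (Fin n)) (v : ℕ → Fin n) (k : ℕ) : Prop :=
  v (k - 1) ∈ pa (v k) ∧ v (k + 1) ∈ pa (v k)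

/-- The trail `v 0, …, v m` is blocked by `S`: it has an interior non-collider
vertex in `S`, or an interior collider vertex such that neither it nor any of
its descendants lies in `S`. -/
def Blocked {n : ℕ} (pa : Fin n → Finset (Fin n)) (S : Set (Fin n)) (m : ℕ)
    (v : ℕ → Fin n) : Prop :=
  ∃ k, 0 < k ∧ k < m ∧
    ((¬ IsCollider pa v k ∧ v k ∈ S) ∨
      (IsCollider pa v k ∧ v k ∉ S ∧ ∀ d, Desc pa (v k) d → d ∉ S))

/-- `S` d-separates `A` and `B`: every trail from a vertex of `A` to a vertex
of `B` is blocked by `S`. -/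
def DSep {n : ℕ} (pa : Fin n → Finset (Fin n)) (A B S : Set (Fin n)) : Prop :=
  ∀ m (v : ℕ → Fin n), IsTrail pa m v → v 0 ∈ A → v m ∈ B → Blocked pa S m v

/-- `A` and `B` are conditionally independent given `S` with respect to `U`. -/
def CondIndep {n : ℕ} {D : Fin n → Type*} (U : Set (∀ j, D j))
    (A B S : Set (Fin n)) : Prop :=
  ∀ u ∈ U, ∀ w ∈ U, (∀ k ∈ S, u k = w k) →
    ∃ z ∈ U, (∀ k ∈ A ∪ S, z k = u k) ∧ ∀ k ∈ B, z k = w k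

/-- A vertex of `A` and a vertex of `B` cannot be adjacent if `S` d-separates `A` and `B`. -/
theorem DSep.not_adj {n : ℕ} {pa : Fin n → Finset (Fin n)} {A B S : Set (Fin n)}
    (hsep : DSep pa A B S) (hAB : Disjoint A B) {a b : Fin n} (ha : a ∈ A) (hb : b ∈ B) :
    ¬ (a ∈ pa b ∨ b ∈ pa a) := by
  intro hadj
  have hne : a ≠ b := hAB.ne_of_mem ha hb
  obtain ⟨k, hk0, hk1, -⟩ := hsep 1 (fun k => if k = 0 then a else b)
    ⟨le_rfl, by
      intro k l hk hl hkl
      interval_cases k <;> interval_cases l <;> simp_all, by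
      intro k hk
      interval_cases k
      simpa using hadj⟩ (by simpa using ha) (by simpa using hb)
  omega

/-- A vertex of `S` cannot have parents in both `A` and `B` if `S` d-separates `A` and `B`. -/
theorem DSep.not_common_child {n : ℕ} {pa : Fin n → Finset (Fin n)} {A B S : Set (Fin n)}
    (hsep : DSep pa A B S) (hAB : Disjoint A B) (hAS : Disjoint A S) (hBS : Disjoint B S)
    {a b s : Fin n} (ha : a ∈ A) (hb : b ∈ B) (hs : s ∈ S) :
    ¬ (a ∈ pa s ∧ b ∈ pa s) := by
  rintro ⟨has, hbs⟩
  have hab : a ≠ b := hAB.ne_of_mem ha hb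
  have has' : a ≠ s := hAS.ne_of_mem ha hs
  have hbs' : b ≠ s := hBS.ne_of_mem hb hs
  obtain ⟨k, hk0, hk1, hk⟩ := hsep 2 (fun k => if k = 0 then a else if k = 1 then s else b)
    ⟨by norm_num, by
      intro k l hk hl hkl
      interval_cases k <;> interval_cases l <;> simp_all [eq_comm], by
      intro k hk
      interval_cases k <;> simp [has, hbs]⟩ (by simpa using ha) (by simpa using hb)
  obtain rfl : k = 1 := by omega
  simp [IsCollider, has, hbs, hs] at hk

/-- If `S` d-separates `A` and `B` and the three sets span all vertices, no family
`{i} ∪ pa i` meets both `A` and `B`. -/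
theorem DSep.family_disjoint {n : ℕ} {pa : Fin n → Finset (Fin n)} {A B S : Set (Fin n)}
    (hsep : DSep pa A B S) (hAB : Disjoint A B) (hAS : Disjoint A S) (hBS : Disjoint B S)
    (hspan : A ∪ B ∪ S = Set.univ) {i a b : Fin n} (ha : a ∈ A) (hb : b ∈ B)
    (hai : a = i ∨ a ∈ pa i) (hbi : b = i ∨ b ∈ pa i) : False := by
  rcases hai with rfl | hai
  · rcases hbi with rfl | hbi
    · exact hAB.ne_of_mem ha hb rfl
    · exact hsep.not_adj hAB ha hb (.inr hbi)
  · rcases hbi with rfl | hbi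
    · exact hsep.not_adj hAB ha hb (.inl hai)
    · have hi : i ∈ A ∪ B ∪ S := hspan ▸ Set.mem_univ i
      rcases hi with (hi | hi) | hi
      · exact hsep.not_adj hAB hi hb (.inr hbi)
      · exact hsep.not_adj hAB ha hi (.inl hai)
      · exact hsep.not_common_child hAB hAS hBS ha hb hi ⟨hai, hbi⟩

/-- d-separation implies conditional independence (spanning case): for a
Bayesian uncertainty network with joint uncertainty set `⋂ i, C i` and all
constraints always definite, if `A`, `B`, `S` are pairwise disjoint, span all
vertices, and `S` d-separates `A` and `B`, then `A` and `B` are conditionally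
independent given `S`. -/
theorem dsep_implies_condIndep_spanning {n : ℕ}
    (pa : Fin n → Finset (Fin n)) (hpa : ∀ i j, j ∈ pa i → j < i)
    (D : Fin n → Type*) (hD : ∀ i, Nonempty (D i))
    (C : Fin n → Set (∀ j, D j))
    (hloc : ∀ i (x x' : ∀ j, D j),
      (∀ j, (j = i ∨ j ∈ pa i) → x j = x' j) → (x ∈ C i ↔ x' ∈ C i))
    (hdef : ∀ i (x : ∀ k, D k), ∃ v : D i, Function.update x i v ∈ C i)
    (A B S : Set (Fin n))
    (hAB : Disjoint A B) (hAS : Disjoint A S) (hBS : Disjoint B S)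
    (hspan : A ∪ B ∪ S = Set.univ)
    (hsep : DSep pa A B S) :
    CondIndep (⋂ i, C i) A B S := by
  classical
  intro u hu w hw huw
  rw [Set.mem_iInter] at hu hw
  refine ⟨fun k => if k ∈ B then w k else u k, Set.mem_iInter.2 fun i => ?_, ?_, ?_⟩
  · by_cases h : ∃ b ∈ B, b = i ∨ b ∈ pa i
    · obtain ⟨b, hb, hbi⟩ := h
      refine (hloc i _ w fun j hj => ?_).2 (hw i)
      have hjV : j ∈ A ∪ B ∪ S := hspan ▸ Set.mem_univ j
      rcases hjV with (hjA | hjB) | hjS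
      · exact (hsep.family_disjoint hAB hAS hBS hspan hjA hb hj hbi).elim
      · exact if_pos hjB
      · exact (if_neg (hBS.notMem_of_mem_right hjS)).trans (huw j hjS)
    · exact (hloc i _ u fun j hj => if_neg fun hjB => h ⟨j, hjB, hj⟩).2 (hu i)
  · rintro k (hk | hk)
    · exact if_neg (hAB.notMem_of_mem_left hk)
    · exact if_neg (hBS.notMem_of_mem_right hk)
  · exact fun k hk => if_pos hk
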